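/- There exists a function g : ℝ → ℝ which is infinitely differentiable on ℝ, satisfies g(z) = (coth(√z) − (√z)⁻¹)/√z for every z > 0, and whose derivatives of all orders k ≥ 0 are bounded on [0,∞), i.e., sup_{z ≥ 0} |g^{(k)}(z)| < ∞ for every k. In other words, the function z ↦ L_1(√z)/√z belongs to C_B^∞([0,∞)). -/

import Mathlib

/-- The real hyperbolic cotangent. -/
noncomputable def Real.coth (z : ℝ) : ℝ := Real.cosh z / Real.sinh z

namespace LangevinAux

/-- `k`-th derivative of the `n`-th Mittag-Leffler term `2 / (z + (n+1)²π²)`. -/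
noncomputable def T (k n : ℕ) (z : ℝ) : ℝ :=
  2 * (-1) ^ k * (k.factorial : ℝ) * ((z + ((n : ℝ) + 1) ^ 2 * Real.pi ^ 2) ^ (k + 1))⁻¹

noncomputable def S (k : ℕ) (z : ℝ) : ℝ := ∑' n, T k n z

noncomputable def u (k n : ℕ) : ℝ := 2 * (k.factorial : ℝ) * (((n : ℝ) + 1) ^ 2)⁻¹

lemma den_ge (n : ℕ) {z : ℝ} (hz : -1 < z) :
    ((n : ℝ) + 1) ^ 2 ≤ z + ((n : ℝ) + 1) ^ 2 * Real.pi ^ 2 := by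
  have h1 : (1 : ℝ) ≤ ((n : ℝ) + 1) ^ 2 := by
    have : (0 : ℝ) ≤ n := Nat.cast_nonneg n
    nlinarith
  have h2 : (9 : ℝ) ≤ Real.pi ^ 2 := by nlinarith [Real.pi_gt_three]
  nlinarith

lemma one_le_sq (n : ℕ) : (1 : ℝ) ≤ ((n : ℝ) + 1) ^ 2 := by
  have : (0 : ℝ) ≤ n := Nat.cast_nonneg n
  nlinarith

lemma summable_u (k : ℕ) : Summable (u k) := by
  have h : Summable (fun n : ℕ => ((n : ℝ) ^ 2)⁻¹) :=
    Real.summable_nat_pow_inv.2 (by norm_num)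
  have h2 := (summable_nat_add_iff 1).2 h
  have h3 := h2.mul_left (2 * (k.factorial : ℝ))
  refine h3.congr fun n => ?_
  simp [u]

lemma T_le (k n : ℕ) {z : ℝ} (hz : -1 < z) : ‖T k n z‖ ≤ u k n := by
  have h1 := one_le_sq n
  have h2 := den_ge n hz
  set D := z + ((n : ℝ) + 1) ^ 2 * Real.pi ^ 2 with hD
  have hD1 : 1 ≤ D := h1.trans h2
  have hp : D ≤ D ^ (k + 1) := le_self_pow₀ hD1 (by omega)
  have hpos : 0 < D ^ (k + 1) := by positivity
  have : ‖T k n z‖ = 2 * (k.factorial : ℝ) * (D ^ (k + 1))⁻¹ := by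
    unfold T
    rw [← hD, norm_mul, norm_mul, norm_mul, norm_pow, norm_neg, norm_one, one_pow, mul_one,
      norm_inv, Real.norm_of_nonneg hpos.le, Real.norm_of_nonneg (by positivity),
      Real.norm_of_nonneg (by norm_num)]
  rw [this, u]
  gcongr
  exact h2.trans hp

lemma T_deriv (k n : ℕ) {z : ℝ} (hz : -1 < z) : HasDerivAt (T k n) (T (k + 1) n z) z := by
  have h1 := one_le_sq n
  have h2 := den_ge n hz
  have hD : z + ((n : ℝ) + 1) ^ 2 * Real.pi ^ 2 ≠ 0 := by linarith
  have h3 : HasDerivAt (fun z : ℝ => z + ((n : ℝ) + 1) ^ 2 * Real.pi ^ 2) 1 z :=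
    (hasDerivAt_id z).add_const _
  have h4 := ((h3.fun_pow (k + 1)).fun_inv (pow_ne_zero _ hD)).const_mul
    (2 * (-1) ^ k * (k.factorial : ℝ))
  refine h4.congr_deriv ?_
  unfold T
  rw [Nat.factorial_succ]
  push_cast
  field_simp
  ring

lemma S_deriv (k : ℕ) {z : ℝ} (hz : -1 < z) : HasDerivAt (S k) (S (k + 1) z) z := by
  refine hasDerivAt_tsum_of_isPreconnected (summable_u (k + 1)) (t := Set.Ioi (-1)) isOpen_Ioi
    isPreconnected_Ioi (fun n y hy => T_deriv k n hy) (fun n y hy => T_le (k + 1) n hy)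
    (y₀ := 0) (by simp) ?_ hz
  exact Summable.of_norm_bounded (summable_u k) (fun n => T_le k n (by norm_num))

lemma S_le (k : ℕ) {z : ℝ} (hz : -1 < z) : |S k z| ≤ ∑' n, u k n :=
  tsum_of_norm_bounded (summable_u k).hasSum (fun n => T_le k n hz)

lemma S_contDiff_nat (m : ℕ) : ∀ k, ContDiffOn ℝ m (S k) (Set.Ioi (-1)) := by
  induction m with
  | zero =>
    intro k
    exact contDiffOn_zero.2 fun z hz => (S_deriv k hz).continuousAt.continuousWithinAt
  | succ m ih =>
    intro k
    push_cast
    rw [contDiffOn_succ_iff_deriv_of_isOpen isOpen_Ioi]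
    refine ⟨fun z hz => (S_deriv k hz).differentiableAt.differentiableWithinAt, by simp, ?_⟩
    exact (ih (k + 1)).congr fun z hz => (S_deriv k hz).deriv

lemma S_contDiff (k : ℕ) : ContDiffOn ℝ (⊤ : ℕ∞) (S k) (Set.Ioi (-1)) :=
  contDiffOn_infty.2 fun m => S_contDiff_nat m k

lemma coth_series {s : ℝ} (hs : 0 < s) :
    Real.coth s - s⁻¹ = s * S 0 (s ^ 2) := by
  have hpi : (Real.pi : ℂ) ≠ 0 := by exact_mod_cast Real.pi_ne_zero
  have hsc : (s : ℂ) ≠ 0 := by exact_mod_cast hs.ne'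
  have hsinh : Complex.sinh (s : ℂ) ≠ 0 := by
    rw [← Complex.ofReal_sinh]
    exact_mod_cast (Real.sinh_pos_iff.2 hs).ne'
  set x : ℂ := (s : ℂ) / Real.pi * Complex.I with hx
  have hxim : x.im = s / Real.pi := by
    rw [hx, ← Complex.ofReal_div]
    simp
  have hq : 0 < s / Real.pi := div_pos hs Real.pi_pos
  have hmem : x ∈ Complex.integerComplement := by
    rw [Complex.mem_integerComplement_iff]
    rintro ⟨n, hn⟩
    have := congrArg Complex.im hn
    rw [hxim] at this
    rw [Complex.intCast_im] at this
    exact hq.ne this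
  have key := cot_series_rep' hmem
  have hpx : (Real.pi : ℂ) * x = s * Complex.I := by
    rw [hx]; field_simp
  have hL : (Real.pi : ℂ) * Complex.cot (Real.pi * x) - 1 / x
      = -(Complex.I * Real.pi) * ((Real.coth s - s⁻¹ : ℝ) : ℂ) := by
    rw [hpx, Complex.cot, Complex.cos_mul_I, Complex.sin_mul_I, hx, Real.coth]
    push_cast
    field_simp
    rw [Complex.I_sq]
    ring
  have hR : ∀ n : ℕ, 1 / (x - ((n : ℂ) + 1)) + 1 / (x + ((n : ℂ) + 1))
      = -(Complex.I * Real.pi) * ((s * T 0 n (s ^ 2) : ℝ) : ℂ) := by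
    intro n
    have e1 : x - ((n : ℂ) + 1) ≠ 0 := by
      intro h
      have := congrArg Complex.im h
      have h5 : x.im = 0 := by simpa using this
      exact hq.ne' (hxim ▸ h5)
    have e2 : x + ((n : ℂ) + 1) ≠ 0 := by
      intro h
      have := congrArg Complex.im h
      have h5 : x.im = 0 := by simpa using this
      exact hq.ne' (hxim ▸ h5)
    have e3 : (s : ℂ) ^ 2 + ((n : ℂ) + 1) ^ 2 * (Real.pi : ℂ) ^ 2 ≠ 0 := by
      have : s ^ 2 + ((n : ℝ) + 1) ^ 2 * Real.pi ^ 2 ≠ 0 := by positivity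
      exact_mod_cast this
    have e4 : (x - ((n : ℂ) + 1)) * (x + ((n : ℂ) + 1))
        = -((s : ℂ) ^ 2 + ((n : ℂ) + 1) ^ 2 * (Real.pi : ℂ) ^ 2) / (Real.pi : ℂ) ^ 2 := by
      rw [hx]
      field_simp
      ring_nf
      rw [Complex.I_sq]
      ring
    rw [div_add_div _ _ e1 e2, e4, T]
    push_cast
    rw [hx]
    simp only [zero_add, pow_one, pow_zero, Nat.factorial_zero, Nat.cast_one, mul_one]
    field_simp
    ring
  rw [hL, tsum_congr hR, tsum_mul_left] at key
  have key2 := mul_left_cancel₀ (neg_ne_zero.2 (mul_ne_zero Complex.I_ne_zero hpi)) key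
  rw [← Complex.ofReal_tsum, tsum_mul_left] at key2
  exact_mod_cast key2

noncomputable def g (z : ℝ) : ℝ := Real.smoothTransition (2 * z + 1) * S 0 z

lemma g_contDiff : ContDiff ℝ (⊤ : ℕ∞) g := by
  rw [contDiff_iff_contDiffAt]
  intro z
  by_cases hz : -1 < z
  · have h1 : ContDiffAt ℝ (⊤ : ℕ∞) (fun z : ℝ => Real.smoothTransition (2 * z + 1)) z :=
      (Real.smoothTransition.contDiff.comp
        ((contDiff_const.mul contDiff_id).add contDiff_const)).contDiffAt
    exact h1.mul ((S_contDiff 0).contDiffAt (Ioi_mem_nhds hz))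
  · have hz' : z < -(1 / 2) := by linarith
    have : g =ᶠ[nhds z] fun _ => 0 := by
      filter_upwards [Iio_mem_nhds hz'] with y hy
      have hy' : y < -(1 / 2) := hy
      rw [g, Real.smoothTransition.zero_of_nonpos (by linarith), zero_mul]
    exact contDiffAt_const.congr_of_eventuallyEq this

lemma g_iter (k : ℕ) : ∀ z : ℝ, 0 < z → iteratedDeriv k g z = S k z := by
  induction k with
  | zero =>
    intro z hz
    rw [iteratedDeriv_zero, g, Real.smoothTransition.one_of_one_le (by linarith), one_mul]
  | succ k ih =>
    intro z hz
    have : iteratedDeriv k g =ᶠ[nhds z] S k := by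
      filter_upwards [Ioi_mem_nhds hz] with y hy using ih y hy
    rw [iteratedDeriv_succ, this.deriv_eq, (S_deriv k (by linarith)).deriv]

end LangevinAux

/-- There exists a smooth function `g : ℝ → ℝ` which agrees with
`z ↦ (coth √z − (√z)⁻¹)/√z = L₁(√z)/√z` for `z > 0` and all of whose derivatives
are bounded on `[0, ∞)`; i.e. `z ↦ L₁(√z)/√z` belongs to `C_B^∞([0,∞))`. -/
theorem langevin_sqrt_div_sqrt_smooth_bounded :
    ∃ g : ℝ → ℝ, ContDiff ℝ (⊤ : ℕ∞) g ∧
      (∀ z : ℝ, 0 < z →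
        g z = (Real.coth (Real.sqrt z) - (Real.sqrt z)⁻¹) / Real.sqrt z) ∧
      (∀ k : ℕ, ∃ C : ℝ, ∀ z : ℝ, 0 ≤ z → |iteratedDeriv k g z| ≤ C) := by
  refine ⟨LangevinAux.g, LangevinAux.g_contDiff, ?_, ?_⟩
  · intro z hz
    have hs := Real.sqrt_pos.2 hz
    have h0 := LangevinAux.g_iter 0 z hz
    rw [iteratedDeriv_zero] at h0
    rw [LangevinAux.coth_series hs, Real.sq_sqrt hz.le, h0]
    field_simp
  · intro k
    refine ⟨max |iteratedDeriv k LangevinAux.g 0| (∑' n, LangevinAux.u k n), ?_⟩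
    intro z hz
    rcases hz.eq_or_lt with rfl | hz
    · exact le_max_left _ _
    · rw [LangevinAux.g_iter k z hz]
      exact (LangevinAux.S_le k (by linarith)).trans (le_max_right _ _)
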